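/- arXiv:math-ph/0003015 — 3 statements merged into one kernel-verified Lean document; each statement's English description precedes it below -/
import Mathlib

section
/- Let V be a real vector space with a quadratic form Q, and let ι : V → CliffordAlgebra Q be the canonical embedding. Let ξ ∈ V with ξ ≠ 0 and Q(ξ) = 0 (ξ is isotropic). Then for every α ∈ ℝ and β ∈ V, the equation ι(ξ) * (algebraMap ℝ (CliffordAlgebra Q) α + ι(β)) = 0 holds if and only if α = 0 and there exists λ ∈ ℝ with β = λ • ξ. -/
/-- A sum of a scalar and a vector vanishes in the Clifford algebra only if both vanish. -/
theorem CliffordAlgebra.algebraMap_add_ι_eq_zero_iff {K V : Type*} [Field K] [Invertible (2 : K)]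
    [AddCommGroup V] [Module K V] (Q : QuadraticForm K V) (a : K) (v : V) :
    algebraMap K (CliffordAlgebra Q) a + CliffordAlgebra.ι Q v = 0 ↔ a = 0 ∧ v = 0 := by
  have inj : Function.Injective (algebraMap K (CliffordAlgebra Q)) :=
    FaithfulSMul.algebraMap_injective K (CliffordAlgebra Q)
  refine ⟨fun h => ?_, by rintro ⟨rfl, rfl⟩; simp⟩
  have hv : v = 0 := (Module.forall_dual_apply_eq_zero_iff K v).mp fun d => by
    have hd := congrArg (CliffordAlgebra.contractLeft d) h
    rw [map_add, CliffordAlgebra.contractLeft_algebraMap, CliffordAlgebra.contractLeft_ι,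
      zero_add, map_zero] at hd
    exact (map_eq_zero_iff _ inj).mp hd
  rw [hv, map_zero, add_zero] at h
  exact ⟨(map_eq_zero_iff _ inj).mp h, hv⟩


/-- In the Clifford algebra of a real quadratic form `Q`, for an
isotropic nonzero vector `ξ`, the product `ι ξ * (α·1 + ι β)` vanishes iff `α = 0`
and `β` is a real multiple of `ξ`. -/
theorem clifford_isotropic_kernel {V : Type*} [AddCommGroup V] [Module ℝ V]
    (Q : QuadraticForm ℝ V) (ξ : V) (hξ : ξ ≠ 0) (hQξ : Q ξ = 0)
    (α : ℝ) (β : V) :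
    CliffordAlgebra.ι Q ξ *
        (algebraMap ℝ (CliffordAlgebra Q) α + CliffordAlgebra.ι Q β) = 0 ↔
      α = 0 ∧ ∃ l : ℝ, β = l • ξ := by
  let := invertibleOfNonzero (two_ne_zero (α := ℝ))
  constructor
  · intro h
    obtain ⟨d, hd⟩ := Module.Projective.exists_dual_eq_one ℝ hξ
    have hc := congrArg (CliffordAlgebra.contractLeft d) h
    rw [CliffordAlgebra.contractLeft_ι_mul, map_add, CliffordAlgebra.contractLeft_algebraMap,
      CliffordAlgebra.contractLeft_ι, zero_add, map_zero, hd, one_smul, ← Algebra.commutes,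
      ← Algebra.smul_def, ← map_smul, add_sub_assoc, ← map_sub,
      CliffordAlgebra.algebraMap_add_ι_eq_zero_iff] at hc
    exact ⟨hc.1, d β, sub_eq_zero.mp hc.2⟩
  · rintro ⟨rfl, l, rfl⟩
    simp [hQξ]
end

section
/- Let γ^0, γ^1, γ^2, γ^3 be Dirac matrices. If ξ ∈ ℝ⁴ satisfies ξ ≠ 0 and ξ·ξ = 0, then the matrix ξ̸ = Σ_μ ξ_μ γ^μ has rank exactly 2. -/
/-- The Minkowski metric `η = diag(1, −1, −1, −1)` as a `ℂ`-valued symbol. -/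
def minkowskiEta (μ ν : Fin 4) : ℂ :=
  if μ = ν then (if μ = 0 then 1 else -1) else 0

/-- A family `γ^0, γ^1, γ^2, γ^3` of Dirac matrices: 4×4 complex matrices
satisfying `γ^μ γ^ν + γ^ν γ^μ = 2 η^{μν} · 1`. -/
def IsDiracFamily (γ : Fin 4 → Matrix (Fin 4) (Fin 4) ℂ) : Prop :=
  ∀ μ ν : Fin 4,
    γ μ * γ ν + γ ν * γ μ = (2 * minkowskiEta μ ν) • (1 : Matrix (Fin 4) (Fin 4) ℂ)

/-- The Feynman slash `ξ̸ = Σ_μ ξ_μ γ^μ` of a real covector `ξ`. -/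
noncomputable def slash (γ : Fin 4 → Matrix (Fin 4) (Fin 4) ℂ) (ξ : Fin 4 → ℝ) :
    Matrix (Fin 4) (Fin 4) ℂ :=
  ∑ μ, (ξ μ : ℂ) • γ μ

/-- The Minkowski square `ξ·ξ = ξ_0² − ξ_1² − ξ_2² − ξ_3²`. -/
def minkSq (ξ : Fin 4 → ℝ) : ℝ :=
  ξ 0 ^ 2 - ξ 1 ^ 2 - ξ 2 ^ 2 - ξ 3 ^ 2

/-- The rank of matrices is subadditive. -/
theorem Matrix.rank_add_le_rank_add_rank {m n K : Type*} [Finite m] [Fintype n] [Field K]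
    (A B : Matrix m n K) : (A + B).rank ≤ A.rank + B.rank := by
  have h : (A + B).mulVecLin.range ≤ A.mulVecLin.range ⊔ B.mulVecLin.range := by
    rw [Matrix.mulVecLin_add]
    rintro _ ⟨v, rfl⟩
    exact Submodule.add_mem_sup ⟨v, rfl⟩ ⟨v, rfl⟩
  exact (Submodule.finrank_mono h).trans (Submodule.finrank_add_le_finrank_add_finrank _ _)

/-- A square-zero matrix over a field whose anticommutator with some matrix is a nonzero scalar
has rank half its size. -/
theorem Matrix.two_mul_rank_of_anticommutator_eq_smul_one {n K : Type*} [Fintype n]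
    [DecidableEq n] [Field K] {A B : Matrix n n K} {c : K} (hc : c ≠ 0) (hA : A * A = 0)
    (hAB : A * B + B * A = c • 1) : 2 * A.rank = Fintype.card n := by
  apply le_antisymm
  · have h := Matrix.rank_add_rank_le_card_of_mul_eq_zero hA
    omega
  · have h : (c • (1 : Matrix n n K)).rank = Fintype.card n := by
      apply Matrix.rank_of_isUnit
      exact (isUnit_one).smul (Units.mk0 c hc)
    have h₁ := Matrix.rank_add_le_rank_add_rank (A * B) (B * A)
    have h₂ := Matrix.rank_mul_le_left A B
    have h₃ := Matrix.rank_mul_le_right B A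
    rw [hAB, h] at h₁
    omega

/-- The Clifford relation between `ξ̸` and `γ^ν`. -/
theorem slash_mul_add_mul_slash {γ : Fin 4 → Matrix (Fin 4) (Fin 4) ℂ} (hγ : IsDiracFamily γ)
    (ξ : Fin 4 → ℝ) (ν : Fin 4) :
    slash γ ξ * γ ν + γ ν * slash γ ξ =
      (2 * ∑ μ, (ξ μ : ℂ) * minkowskiEta μ ν) • (1 : Matrix (Fin 4) (Fin 4) ℂ) := by
  simp only [slash, Finset.sum_mul, Finset.mul_sum, smul_mul_assoc, mul_smul_comm,
    ← Finset.sum_add_distrib, ← smul_add, hγ _ ν, smul_smul, Finset.sum_smul]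
  simp only [mul_left_comm]

/-- The square of `ξ̸` is the scalar `ξ·ξ`. -/
theorem slash_mul_self {γ : Fin 4 → Matrix (Fin 4) (Fin 4) ℂ} (hγ : IsDiracFamily γ)
    (ξ : Fin 4 → ℝ) :
    slash γ ξ * slash γ ξ = (minkSq ξ : ℂ) • (1 : Matrix (Fin 4) (Fin 4) ℂ) := by
  have h : (2 : ℂ) • (slash γ ξ * slash γ ξ) =
      ∑ ν, (ξ ν : ℂ) • (slash γ ξ * γ ν + γ ν * slash γ ξ) := by
    have h₁ : ∑ ν, (ξ ν : ℂ) • (slash γ ξ * γ ν) = slash γ ξ * slash γ ξ := by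
      simp only [← mul_smul_comm, ← Finset.mul_sum]
      rfl
    have h₂ : ∑ ν, (ξ ν : ℂ) • (γ ν * slash γ ξ) = slash γ ξ * slash γ ξ := by
      simp only [← smul_mul_assoc, ← Finset.sum_mul]
      rfl
    simp only [smul_add, Finset.sum_add_distrib, h₁, h₂, two_smul]
  simp only [slash_mul_add_mul_slash hγ, smul_smul, ← Finset.sum_smul] at h
  apply smul_right_injective _ (two_ne_zero : (2 : ℂ) ≠ 0)
  simp only [h, smul_smul]
  congr 1
  simp [Fin.sum_univ_four, minkowskiEta, minkSq]
  ring

/-- A nonzero lightlike covector has nonzero time component. -/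
theorem time_ne_zero_of_minkSq_eq_zero {ξ : Fin 4 → ℝ} (hξ : ξ ≠ 0) (h : minkSq ξ = 0) :
    ξ 0 ≠ 0 := by
  intro h₀
  apply hξ
  simp only [minkSq, h₀] at h
  ext μ
  fin_cases μ
  · exact h₀
  all_goals
    apply pow_eq_zero_iff (two_ne_zero) |>.mp
    simp only [Fin.reduceFinMk, Fin.mk_one]
    nlinarith [sq_nonneg (ξ 1), sq_nonneg (ξ 2), sq_nonneg (ξ 3)]

/-- For a nonzero lightlike covector `ξ`, the matrix `ξ̸` has
rank exactly 2. -/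
theorem slash_rank_lightlike (γ : Fin 4 → Matrix (Fin 4) (Fin 4) ℂ)
    (hγ : IsDiracFamily γ) (ξ : Fin 4 → ℝ) (hξ : ξ ≠ 0) (hlight : minkSq ξ = 0) :
    (slash γ ξ).rank = 2 := by
  have hsq : slash γ ξ * slash γ ξ = 0 := by simp [slash_mul_self hγ, hlight]
  have hc : 2 * ∑ μ, (ξ μ : ℂ) * minkowskiEta μ 0 ≠ 0 := by
    simpa [Fin.sum_univ_four, minkowskiEta] using time_ne_zero_of_minkSq_eq_zero hξ hlight
  have h := Matrix.two_mul_rank_of_anticommutator_eq_smul_one hc hsq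
    (slash_mul_add_mul_slash hγ ξ 0)
  rw [Fintype.card_fin] at h
  omega
end

section
/- Let γ^0, γ^1, γ^2, γ^3 be Dirac matrices, and let ξ ∈ ℝ⁴ with ξ ≠ 0 and ξ·ξ = 0. Then for every α ∈ ℂ and β ∈ ℂ⁴, the matrix equation ξ̸ * (α·1 + Σ_ν β_ν γ^ν) = 0 holds if and only if α = 0 and there exists λ ∈ ℂ with β_ν = λ ξ_ν for all ν. In particular, the set of matrices w lying in the linear span of {1, γ^0, γ^1, γ^2, γ^3} with ξ̸ w = 0 is exactly the complex line ℂ·ξ̸. -/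
namespace IsDiracFamily

variable {γ : Fin 4 → Matrix (Fin 4) (Fin 4) ℂ}

theorem anticomm_sum (hγ : IsDiracFamily γ) (μ : Fin 4) (a : Fin 4 → ℂ) :
    γ μ * ∑ ν, a ν • γ ν + (∑ ν, a ν • γ ν) * γ μ =
      (2 * minkowskiEta μ μ * a μ) • (1 : Matrix (Fin 4) (Fin 4) ℂ) := by
  have h (ν : Fin 4) : γ μ * (a ν • γ ν) + (a ν • γ ν) * γ μ =
      (a ν * (2 * minkowskiEta μ ν)) • (1 : Matrix (Fin 4) (Fin 4) ℂ) := by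
    rw [mul_smul_comm, smul_mul_assoc, ← smul_add, hγ μ ν, smul_smul]
  rw [Finset.mul_sum, Finset.sum_mul, ← Finset.sum_add_distrib, Finset.sum_congr rfl fun ν _ => h ν,
    ← Finset.sum_smul, Finset.sum_eq_single μ]
  · congr 1
    ring
  · intro ν _ hν
    simp [minkowskiEta, hν.symm]
  · simp

theorem sum_smul_injective (hγ : IsDiracFamily γ) {a b : Fin 4 → ℂ}
    (h : ∑ ν, a ν • γ ν = ∑ ν, b ν • γ ν) : a = b := by
  funext μ
  have hab := hγ.anticomm_sum μ a
  rw [h, hγ.anticomm_sum μ b] at hab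
  have hη : minkowskiEta μ μ ≠ 0 := by
    unfold minkowskiEta
    split_ifs <;> simp_all
  exact mul_left_cancel₀ (mul_ne_zero two_ne_zero hη) (smul_left_injective ℂ one_ne_zero hab.symm)

theorem slash_mul_self (hγ : IsDiracFamily γ) (ξ : Fin 4 → ℝ) :
    slash γ ξ * slash γ ξ = (minkSq ξ : ℂ) • (1 : Matrix (Fin 4) (Fin 4) ℂ) := by
  have h : slash γ ξ * slash γ ξ + slash γ ξ * slash γ ξ =
      (2 * (minkSq ξ : ℂ)) • (1 : Matrix (Fin 4) (Fin 4) ℂ) := by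
    calc slash γ ξ * slash γ ξ + slash γ ξ * slash γ ξ
        = ∑ μ, (ξ μ : ℂ) • (γ μ * slash γ ξ + slash γ ξ * γ μ) := by
          simp_rw [smul_add, Finset.sum_add_distrib, ← smul_mul_assoc, ← Finset.sum_mul,
            smul_mul_assoc, ← mul_smul_comm, ← Finset.mul_sum]
          rfl
      _ = ∑ μ, ((ξ μ : ℂ) * (2 * minkowskiEta μ μ * ξ μ)) •
            (1 : Matrix (Fin 4) (Fin 4) ℂ) := by
          refine Finset.sum_congr rfl fun μ _ => ?_
          rw [slash, hγ.anticomm_sum μ fun ν => (ξ ν : ℂ), smul_smul]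
      _ = (2 * (minkSq ξ : ℂ)) • (1 : Matrix (Fin 4) (Fin 4) ℂ) := by
          rw [← Finset.sum_smul]
          congr 1
          simp [Fin.sum_univ_four, minkowskiEta, minkSq]
          ring
  rw [← two_smul ℂ, mul_smul] at h
  exact smul_right_injective _ two_ne_zero h

theorem isUnit (hγ : IsDiracFamily γ) (μ : Fin 4) : IsUnit (γ μ) := by
  have h := hγ μ μ
  rw [← two_smul ℂ, mul_smul] at h
  replace h := smul_right_injective _ two_ne_zero h
  have hη : minkowskiEta μ μ * minkowskiEta μ μ = 1 := by
    unfold minkowskiEta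
    split_ifs <;> simp_all
  refine IsUnit.of_mul_eq_one (minkowskiEta μ μ • γ μ) ?_
  rw [mul_smul_comm]
  refine (congrArg _ h).trans ?_
  rw [smul_smul, hη, one_smul]

theorem semiconjBy_neg (hγ : IsDiracFamily γ) {μ ν : Fin 4} (h : μ ≠ ν) :
    SemiconjBy (γ μ) (γ ν) (-γ ν) := by
  have := hγ μ ν
  simp only [minkowskiEta, h, if_false, mul_zero, zero_smul] at this
  rw [SemiconjBy, neg_mul]
  exact eq_neg_of_add_eq_zero_left this

/-- The chirality matrix `γ^0 γ^1 γ^2 γ^3` anticommutes with every Dirac matrix. -/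
theorem chirality_semiconjBy (hγ : IsDiracFamily γ) (μ : Fin 4) :
    SemiconjBy (γ 0 * γ 1 * γ 2 * γ 3) (γ μ) (-γ μ) := by
  have h {ν : Fin 4} (hν : ν ≠ μ) : SemiconjBy (γ ν) (γ μ) (-γ μ) := hγ.semiconjBy_neg hν
  have h' {ν : Fin 4} (hν : ν ≠ μ) : SemiconjBy (γ ν) (-γ μ) (γ μ) := by
    simpa using (h hν).neg_right
  have hs : SemiconjBy (γ μ) (γ μ) (γ μ) := rfl
  have hs' : SemiconjBy (γ μ) (-γ μ) (-γ μ) := hs.neg_right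
  fin_cases μ
  · exact ((hs'.mul_left (h (by decide))).mul_left (h' (by decide))).mul_left (h (by decide))
  · exact (((h (by decide)).mul_left hs).mul_left (h' (by decide))).mul_left (h (by decide))
  · exact (((h (by decide)).mul_left (h' (by decide))).mul_left hs').mul_left (h (by decide))
  · exact (((h (by decide)).mul_left (h' (by decide))).mul_left (h (by decide))).mul_left hs

theorem chirality_mul_sum (hγ : IsDiracFamily γ) (a : Fin 4 → ℂ) :
    (γ 0 * γ 1 * γ 2 * γ 3) * ∑ ν, a ν • γ ν =
      -((∑ ν, a ν • γ ν) * (γ 0 * γ 1 * γ 2 * γ 3)) := by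
  rw [Finset.mul_sum, Finset.sum_mul, ← Finset.sum_neg_distrib]
  refine Finset.sum_congr rfl fun ν _ => ?_
  rw [mul_smul_comm, (hγ.chirality_semiconjBy ν).eq, smul_mul_assoc, neg_mul, smul_neg]

/-- Even and odd parts of an annihilated element are annihilated separately. -/
theorem sum_mul_eq_zero_of_mul_add (hγ : IsDiracFamily γ) {a β : Fin 4 → ℂ} {α : ℂ}
    (h : (∑ ν, a ν • γ ν) * (α • (1 : Matrix (Fin 4) (Fin 4) ℂ) + ∑ ν, β ν • γ ν) = 0) :
    α • ∑ ν, a ν • γ ν = 0 ∧ (∑ ν, a ν • γ ν) * ∑ ν, β ν • γ ν = 0 := by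
  have hA := hγ.chirality_mul_sum a
  have hB := hγ.chirality_mul_sum β
  have hG : IsUnit (γ 0 * γ 1 * γ 2 * γ 3) :=
    (((hγ.isUnit 0).mul (hγ.isUnit 1)).mul (hγ.isUnit 2)).mul (hγ.isUnit 3)
  generalize γ 0 * γ 1 * γ 2 * γ 3 = G at hA hB hG
  generalize ∑ ν, a ν • γ ν = A at *
  generalize ∑ ν, β ν • γ ν = B at *
  rw [mul_add, mul_smul_comm, mul_one] at h
  have hAB : G * (A * B) = A * B * G := by
    rw [← mul_assoc, hA, neg_mul, mul_assoc, hB, mul_neg, neg_neg, mul_assoc]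
  have h' : (α • A - A * B) * G = 0 := by
    have := congrArg (G * ·) h
    simp only [mul_add, mul_smul_comm, hA, hAB, mul_zero, smul_neg] at this
    rw [sub_mul, smul_mul_assoc, ← neg_eq_zero, neg_sub, sub_eq_neg_add, this]
  have h'' : α • A = A * B := sub_eq_zero.mp (hG.mul_left_eq_zero.mp h')
  rw [← h'', ← two_smul ℂ] at h
  have hα : α • A = 0 := (smul_eq_zero.mp h).resolve_left two_ne_zero
  exact ⟨hα, h'' ▸ hα⟩

theorem smul_sum_eq_of_mul_eq_zero (hγ : IsDiracFamily γ) {a β : Fin 4 → ℂ}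
    (h : (∑ ν, a ν • γ ν) * ∑ ν, β ν • γ ν = 0) :
    a 0 • ∑ ν, β ν • γ ν = β 0 • ∑ ν, a ν • γ ν := by
  have hA := hγ.anticomm_sum 0 a
  have hB := hγ.anticomm_sum 0 β
  generalize ∑ ν, a ν • γ ν = A at *
  generalize ∑ ν, β ν • γ ν = B at *
  simp only [minkowskiEta, if_true, mul_one, mul_smul] at hA hB
  have key : (2 : ℂ) • a 0 • B = (2 : ℂ) • β 0 • A := by
    calc (2 : ℂ) • a 0 • B = (γ 0 * A + A * γ 0) * B := by simp [hA]
      _ = A * (γ 0 * B + B * γ 0) := by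
          rw [add_mul, mul_add, mul_assoc, ← mul_assoc A B, h, mul_zero, zero_mul, zero_add,
            add_zero, mul_assoc]
      _ = (2 : ℂ) • β 0 • A := by simp [hB]
  exact smul_right_injective _ two_ne_zero key

end IsDiracFamily

theorem apply_zero_ne_zero_of_minkSq_eq_zero {ξ : Fin 4 → ℝ} (hξ : ξ ≠ 0)
    (hlight : minkSq ξ = 0) : ξ 0 ≠ 0 := by
  contrapose! hξ
  simp only [minkSq, hξ] at hlight
  funext μ
  fin_cases μ
  · exact hξ
  all_goals
    refine pow_eq_zero_iff two_ne_zero |>.mp ?_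
    simp only [Fin.mk_one, Fin.reduceFinMk]
    nlinarith [sq_nonneg (ξ 1), sq_nonneg (ξ 2), sq_nonneg (ξ 3)]

/-- For a nonzero lightlike `ξ`, the only matrices
`w = α·1 + Σ_ν β_ν γ^ν` with `ξ̸ w = 0` are the complex multiples of `ξ̸`:
`α` must vanish and `β` must be proportional to `ξ`. In particular, the set of
matrices in the span of `{1, γ^0, γ^1, γ^2, γ^3}` annihilated by `ξ̸` on the
left is exactly the complex line `ℂ · ξ̸`. -/
theorem slash_kernel_lightlike (γ : Fin 4 → Matrix (Fin 4) (Fin 4) ℂ)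
    (hγ : IsDiracFamily γ) (ξ : Fin 4 → ℝ) (hξ : ξ ≠ 0) (hlight : minkSq ξ = 0) :
    (∀ (α : ℂ) (β : Fin 4 → ℂ),
        slash γ ξ * (α • (1 : Matrix (Fin 4) (Fin 4) ℂ) + ∑ ν, β ν • γ ν) = 0 ↔
          α = 0 ∧ ∃ l : ℂ, ∀ ν, β ν = l * (ξ ν : ℂ)) ∧
      {w : Matrix (Fin 4) (Fin 4) ℂ |
          w ∈ Submodule.span ℂ (insert (1 : Matrix (Fin 4) (Fin 4) ℂ) (Set.range γ)) ∧
            slash γ ξ * w = 0} =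
        {w : Matrix (Fin 4) (Fin 4) ℂ | ∃ l : ℂ, w = l • slash γ ξ} := by
  have hξ0 : (ξ 0 : ℂ) ≠ 0 :=
    Complex.ofReal_ne_zero.mpr (apply_zero_ne_zero_of_minkSq_eq_zero hξ hlight)
  have hsq : slash γ ξ * slash γ ξ = 0 := by simp [hγ.slash_mul_self, hlight]
  have hne : slash γ ξ ≠ 0 := fun h =>
    hξ0 (congrFun (hγ.sum_smul_injective (a := fun ν => (ξ ν : ℂ)) (b := 0)
      (h.trans (by simp))) 0)
  have hsum (l : ℂ) : ∑ ν, (l * (ξ ν : ℂ)) • γ ν = l • slash γ ξ := by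
    simp only [slash, Finset.smul_sum, mul_smul]
  have hiff (α : ℂ) (β : Fin 4 → ℂ) :
      slash γ ξ * (α • (1 : Matrix (Fin 4) (Fin 4) ℂ) + ∑ ν, β ν • γ ν) = 0 ↔
        α = 0 ∧ ∃ l : ℂ, ∀ ν, β ν = l * (ξ ν : ℂ) := by
    constructor
    · intro h
      obtain ⟨hα, hβ⟩ := hγ.sum_mul_eq_zero_of_mul_add (a := fun ν => (ξ ν : ℂ)) h
      refine ⟨(smul_eq_zero.mp hα).resolve_right hne, β 0 / ξ 0, fun ν => ?_⟩
      refine congrFun (hγ.sum_smul_injective (b := fun ν => β 0 / ξ 0 * (ξ ν : ℂ)) ?_) ν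
      rw [hsum, div_eq_inv_mul, mul_smul, eq_inv_smul_iff₀ hξ0]
      exact hγ.smul_sum_eq_of_mul_eq_zero hβ
    · rintro ⟨rfl, l, hl⟩
      simp only [hl, hsum, zero_smul, zero_add, mul_smul_comm, hsq, smul_zero]
  refine ⟨hiff, Set.ext fun w => ⟨?_, ?_⟩⟩
  · rintro ⟨hw, h0⟩
    obtain ⟨α, z, hz, rfl⟩ := Submodule.mem_span_insert.mp hw
    obtain ⟨β, rfl⟩ := (Submodule.mem_span_range_iff_exists_fun ℂ).mp hz
    obtain ⟨rfl, l, hl⟩ := (hiff α β).mp h0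
    exact ⟨l, by simp only [hl, hsum, zero_smul, zero_add]⟩
  · rintro ⟨l, rfl⟩
    refine ⟨Submodule.smul_mem _ _ (Submodule.sum_mem _ fun ν _ => Submodule.smul_mem _ _
      (Submodule.subset_span (Set.mem_insert_of_mem _ (Set.mem_range_self ν)))), ?_⟩
    rw [mul_smul_comm, hsq, smul_zero]
end
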